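/- Let Γ be a set of topological lines in ℝ² such that γ \ γ' is a portion of γ for all distinct γ, γ' ∈ Γ, and for distinct γ, γ' let J(γ,γ') := cl(γ △ γ') be the associated Jordan curve. Then for all distinct γ, σ, σ' ∈ Γ, cl(Int J(γ, σ')) \ cl(Int J(γ, σ)) ⊂ cl(Int J(σ, σ')). -/

import Mathlib

abbrev Plane := ℝ × ℝ

/-- A topological line: a subset of the plane homeomorphic to `ℝ`. -/
def IsTopLine (γ : Set Plane) : Prop := Nonempty (ℝ ≃ₜ γ)

/-- A portion of a topological line `γ` : a subset whose preimage under any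
parametrizing homeomorphism `ℝ ≃ₜ γ` is a bounded open interval. -/
def IsPortion (γ π : Set Plane) : Prop :=
  π ⊆ γ ∧ ∀ Φ : ℝ ≃ₜ γ, ∃ a b : ℝ, {t : ℝ | (Φ t : Plane) ∈ π} = Set.Ioo a b

/-- A Jordan curve: a subset of the plane homeomorphic to the circle. -/
def IsJordanCurve (J : Set Plane) : Prop := Nonempty (Circle ≃ₜ J)

/-- Interior region of a Jordan curve. -/
def intRegion (J : Set Plane) : Set Plane :=
  {z | z ∉ J ∧ Bornology.IsBounded (connectedComponentIn Jᶜ z)}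

/-- Exterior region of a Jordan curve. -/
def extRegion (J : Set Plane) : Set Plane :=
  {z | z ∉ J ∧ ¬ Bornology.IsBounded (connectedComponentIn Jᶜ z)}

/-- The Jordan curve associated with two topological lines. -/
noncomputable def lineJ (γ γ' : Set Plane) : Set Plane := closure (symmDiff γ γ')

open Set Topology

/-- The identification of the plane with `ℂ`. -/
noncomputable def planeEquivComplex : Plane ≃L[ℝ] ℂ := Complex.equivRealProdCLM.symm

/-- `g` is a continuous logarithm of `w - p` on `K`. -/
def IsLogOn (g : Plane → ℂ) (K : Set Plane) (p : Plane) : Prop :=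
  ContinuousOn g K ∧ ∀ w ∈ K, Complex.exp (g w) = planeEquivComplex w - planeEquivComplex p

theorem IsLogOn.mono {g : Plane → ℂ} {K L : Set Plane} {p : Plane} (hg : IsLogOn g L p)
    (hKL : K ⊆ L) : IsLogOn g K p :=
  ⟨hg.1.mono hKL, fun w hw => hg.2 w (hKL hw)⟩

/-- Two continuous functions with the same exponential differ by a constant on preconnected sets. -/
theorem sub_eq_sub_of_exp_eq {X : Type*} [TopologicalSpace X] {S : Set X} (hS : IsPreconnected S)
    {g h : X → ℂ} (hg : ContinuousOn g S) (hh : ContinuousOn h S)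
    (he : ∀ w ∈ S, Complex.exp (g w) = Complex.exp (h w)) {x y : X} (hx : x ∈ S) (hy : y ∈ S) :
    g x - h x = g y - h y := by
  have hxe : Complex.exp (g x - h x) = 1 := by
    rw [Complex.exp_sub, he x hx, div_self (Complex.exp_ne_zero _)]
  have key := Complex.isCoveringMap_exp.eqOn_of_comp_eqOn hS hg
    (g₂ := fun w => h w + (g x - h x)) (hh.add continuousOn_const)
    (fun w hw => Subtype.ext (by simp [Complex.exp_add, he w hw, hxe])) hx (by ring)
  have := key hy
  simp only at this
  rw [this]; ring

theorem exists_continuous_log {A : Type*} [TopologicalSpace A] [SimplyConnectedSpace A]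
    [LocallyPathConnectedSpace A] {f : A → ℂ} (hf : Continuous f) (h0 : ∀ a, f a ≠ 0) :
    ∃ F : A → ℂ, Continuous F ∧ ∀ a, Complex.exp (F a) = f a := by
  obtain ⟨a₀⟩ : Nonempty A := inferInstance
  obtain ⟨F, ⟨-, hF⟩, -⟩ := Complex.isCoveringMapOn_exp.existsUnique_continuousMap_lifts
    ⟨f, hf⟩ (a₀ := a₀) (Complex.exp_log (h0 a₀)) (fun a => h0 a)
  exact ⟨F, F.continuous, fun a => congrFun hF a⟩

theorem IsLogOn.sub_eq_sub {g h : Plane → ℂ} {S : Set Plane} {p : Plane} (hg : IsLogOn g S p)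
    (hh : IsLogOn h S p) (hS : IsPreconnected S) {x y : Plane} (hx : x ∈ S) (hy : y ∈ S) :
    g x - h x = g y - h y :=
  sub_eq_sub_of_exp_eq hS hg.1 hh.1 (fun w hw => (hg.2 w hw).trans (hh.2 w hw).symm) hx hy

theorem IsLogOn.exists_of_norm_lt {g : Plane → ℂ} {K : Set Plane} {p q : Plane}
    (hg : IsLogOn g K p)
    (h : ∀ w ∈ K, ‖planeEquivComplex p - planeEquivComplex q‖ <
      ‖planeEquivComplex w - planeEquivComplex p‖) :
    ∃ g', IsLogOn g' K q := by
  have hne : ∀ w ∈ K, planeEquivComplex w - planeEquivComplex p ≠ 0 := fun w hw =>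
    norm_pos_iff.1 ((norm_nonneg _).trans_lt (h w hw))
  have hslit : ∀ w ∈ K, 1 + (planeEquivComplex p - planeEquivComplex q) /
      (planeEquivComplex w - planeEquivComplex p) ∈ Complex.slitPlane := by
    intro w hw
    apply Complex.mem_slitPlane_of_norm_lt_one
    rw [norm_div, div_lt_one (norm_pos_iff.2 (hne w hw))]
    exact h w hw
  refine ⟨fun w => g w + Complex.log (1 + (planeEquivComplex p - planeEquivComplex q) /
      (planeEquivComplex w - planeEquivComplex p)), hg.1.add (ContinuousOn.clog ?_ hslit), ?_⟩
  · exact continuousOn_const.add (continuousOn_const.div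
      (planeEquivComplex.continuous.continuousOn.sub continuousOn_const) hne)
  · intro w hw
    rw [Complex.exp_add, hg.2 w hw, Complex.exp_log (Complex.slitPlane_ne_zero (hslit w hw))]
    field_simp [hne w hw]
    ring

theorem exists_isLogOn_of_far {K : Set Plane} {q : Plane}
    (h : ∀ w ∈ K, ‖planeEquivComplex w‖ < ‖planeEquivComplex q‖) : ∃ g, IsLogOn g K q := by
  by_cases hq : planeEquivComplex q = 0
  · refine ⟨0, continuousOn_const, fun w hw => ?_⟩
    have := h w hw
    rw [hq, norm_zero] at this
    exact absurd this (norm_nonneg _).not_gt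
  have hslit : ∀ w ∈ K, 1 + -(planeEquivComplex w / planeEquivComplex q) ∈
      Complex.slitPlane := by
    intro w hw
    apply Complex.mem_slitPlane_of_norm_lt_one
    rw [norm_neg, norm_div, div_lt_one (norm_pos_iff.2 hq)]
    exact h w hw
  refine ⟨fun w => Complex.log (1 + -(planeEquivComplex w / planeEquivComplex q)) +
    Complex.log (-planeEquivComplex q), (ContinuousOn.clog ?_ hslit).add continuousOn_const, ?_⟩
  · exact continuousOn_const.add
      (planeEquivComplex.continuous.continuousOn.div_const _).neg
  · intro w hw
    rw [Complex.exp_add, Complex.exp_log (Complex.slitPlane_ne_zero (hslit w hw)),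
      Complex.exp_log (neg_ne_zero.2 hq)]
    field_simp
    ring

/-- A point in an unbounded component of the complement of a compact set admits a logarithm. -/
theorem exists_isLogOn_of_not_isBounded {K : Set Plane} (hK : IsCompact K) {p : Plane}
    (hp : p ∉ K) (hU : ¬ Bornology.IsBounded (connectedComponentIn Kᶜ p)) :
    ∃ g, IsLogOn g K p := by
  obtain ⟨M, hM⟩ := (hK.image planeEquivComplex.continuous).isBounded.exists_norm_le
  obtain ⟨q, hqU, hq⟩ : ∃ q ∈ connectedComponentIn Kᶜ p, M < ‖planeEquivComplex q‖ := by
    by_contra! hcon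
    apply hU
    refine (planeEquivComplex.symm.lipschitz.isBounded_image
      (Metric.isBounded_closedBall (x := (0 : ℂ)) (r := M))).subset fun w hw => ?_
    exact ⟨planeEquivComplex w, by simpa using hcon w hw, by simp⟩
  have hqlog : ∃ g, IsLogOn g K q :=
    exists_isLogOn_of_far fun w hw => (hM _ (mem_image_of_mem _ hw)).trans_lt hq
  have hpU : p ∈ connectedComponentIn Kᶜ p := mem_connectedComponentIn hp
  refine isPreconnected_connectedComponentIn.induction₂'
    (fun x y => (∃ g, IsLogOn g K x) → ∃ g, IsLogOn g K y) ?_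
    (fun _ _ _ _ _ _ h h' => h' ∘ h) hqU hpU hqlog
  intro x hx
  have hxK : x ∉ K := connectedComponentIn_subset _ _ hx
  have hcl : IsClosed (planeEquivComplex '' K) :=
    (hK.image planeEquivComplex.continuous).isClosed
  have hxi : planeEquivComplex x ∈ (planeEquivComplex '' K)ᶜ := by
    rintro ⟨w, hw, hwx⟩
    exact hxK (planeEquivComplex.injective hwx ▸ hw)
  obtain ⟨δ, hδ, hball⟩ := Metric.isOpen_iff.1 hcl.isOpen_compl _ hxi
  have hfar : ∀ w ∈ K, δ ≤ ‖planeEquivComplex w - planeEquivComplex x‖ := by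
    intro w hw
    by_contra! hlt
    exact hball (by simpa [dist_eq_norm] using hlt) (mem_image_of_mem _ hw)
  have hev : ∀ᶠ y in 𝓝 x, ‖planeEquivComplex y - planeEquivComplex x‖ < δ / 2 := by
    have := planeEquivComplex.continuous.continuousAt (x := x) (Metric.ball_mem_nhds _ (half_pos hδ))
    filter_upwards [this] with y hy
    simpa [dist_eq_norm] using hy
  filter_upwards [nhdsWithin_le_nhds hev] with y hy
  refine ⟨fun ⟨g, hg⟩ => hg.exists_of_norm_lt fun w hw => ?_,
    fun ⟨g, hg⟩ => hg.exists_of_norm_lt fun w hw => ?_⟩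
  · rw [norm_sub_rev]; linarith [hfar w hw]
  · have h1 := norm_sub_le_norm_sub_add_norm_sub (planeEquivComplex w) (planeEquivComplex y)
      (planeEquivComplex x)
    linarith [hfar w hw]

/-- There is no continuous logarithm of `w - p` on a circle around `p`. -/
theorem not_continuous_log_circle (p : Plane) {R : ℝ} (hR : 0 < R) {H : Plane → ℂ}
    (hH : Continuous H)
    (h : ∀ w, ‖planeEquivComplex w - planeEquivComplex p‖ = R →
      Complex.exp (H w) = planeEquivComplex w - planeEquivComplex p) : False := by
  let q : ℝ → Plane := fun t =>
    planeEquivComplex.symm (planeEquivComplex p + R * Complex.exp (t * Complex.I))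
  have hq : Continuous q := by fun_prop
  have hRC : (R : ℂ) ≠ 0 := by exact_mod_cast hR.ne'
  have hqe : ∀ t, Complex.exp (H (q t)) = Complex.exp (Complex.log R + t * Complex.I) := by
    intro t
    rw [h (q t) (by simp [q, Complex.norm_exp_ofReal_mul_I, abs_of_pos hR]), Complex.exp_add,
      Complex.exp_log hRC]
    simp [q]
  have key := sub_eq_sub_of_exp_eq (S := univ) isPreconnected_univ
    (g := fun t => H (q t)) (h := fun t : ℝ => Complex.log R + t * Complex.I)
    (hH.comp hq).continuousOn (by fun_prop) (fun t _ => hqe t)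
    (mem_univ 0) (mem_univ (2 * Real.pi))
  have hper : q 0 = q (2 * Real.pi) := by
    simp only [q]
    push_cast
    rw [Complex.exp_two_pi_mul_I, zero_mul, Complex.exp_zero]
  simp [← hper, Real.pi_ne_zero] at key

/-- A point in a bounded component of the complement of a closed set admits no logarithm. -/
theorem not_isLogOn_of_isBounded {K : Set Plane} (hK : IsClosed K) {p : Plane}
    (hp : p ∉ K) (hU : Bornology.IsBounded (connectedComponentIn Kᶜ p)) (g : Plane → ℂ) :
    ¬ IsLogOn g K p := by
  classical
  rintro ⟨hgc, hge⟩
  set U := connectedComponentIn Kᶜ p with hUdef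
  have hpU : p ∈ U := mem_connectedComponentIn hp
  have hUo : IsOpen U := hK.isOpen_compl.connectedComponentIn
  have hfr : frontier U ⊆ K := by
    intro x hx
    by_contra hxK
    have hxU : x ∈ U := by
      have hsub : U ⊆ insert x U := subset_insert _ _
      have hpre : IsPreconnected (insert x U) :=
        isPreconnected_connectedComponentIn.subset_closure hsub
          (insert_subset hx.1 subset_closure)
      refine hpre.subset_connectedComponentIn (Or.inr hpU) ?_ (mem_insert _ _)
      exact insert_subset hxK (connectedComponentIn_subset _ _)
    rw [hUo.frontier_eq] at hx
    exact hx.2 hxU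
  obtain ⟨G, hG⟩ := ContinuousMap.exists_restrict_eq hK
    (⟨K.domRestrict g, continuousOn_iff_continuous_domRestrict.1 hgc⟩ : C(K, ℂ))
  have hGK : ∀ w ∈ K, G w = g w := fun w hw => congrArg (fun f : C(K, ℂ) => f ⟨w, hw⟩) hG
  obtain ⟨H, hH, hHe⟩ := exists_continuous_log
    (f := U.piecewise (fun w => Complex.exp (G w))
      fun w => planeEquivComplex w - planeEquivComplex p)
    (Continuous.piecewise (fun w hw => by rw [hGK w (hfr hw), hge w (hfr hw)])
      (by fun_prop) (by fun_prop))
    (fun w => by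
      by_cases hw : w ∈ U
      · simp [hw, Complex.exp_ne_zero]
      · rw [piecewise_eq_of_notMem _ _ _ hw, sub_ne_zero]
        exact fun h => hw (planeEquivComplex.injective h ▸ hpU))
  obtain ⟨R, hR, hUR⟩ := (planeEquivComplex.lipschitz.isBounded_image hU).subset_ball_lt 0
    (planeEquivComplex p)
  refine not_continuous_log_circle p hR hH fun w hw => ?_
  rw [hHe, piecewise_eq_of_notMem]
  intro hwU
  have := hUR (mem_image_of_mem _ hwU)
  rw [Metric.mem_ball, dist_eq_norm] at this
  exact this.ne hw

theorem exists_isLogOn_line {L : Set Plane} (Φ : ℝ ≃ₜ L) {p : Plane} (hp : p ∉ L) :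
    ∃ l, IsLogOn l L p := by
  classical
  obtain ⟨F, hF, hFe⟩ := exists_continuous_log
    (f := fun t => planeEquivComplex (Φ t) - planeEquivComplex p) (by fun_prop)
    (fun t => sub_ne_zero.2 fun h => hp (planeEquivComplex.injective h ▸ (Φ t).2))
  refine ⟨fun w => if h : w ∈ L then F (Φ.symm ⟨w, h⟩) else 0, ?_, fun w hw => ?_⟩
  · rw [continuousOn_iff_continuous_domRestrict]
    convert! hF.comp Φ.symm.continuous using 1
    ext w
    simp [w.2]
  · simp [hw, hFe]

theorem interior_line {L : Set Plane} (Φ : ℝ ≃ₜ L) : interior L = ∅ := by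
  by_contra hne
  obtain ⟨x, hx⟩ := nonempty_iff_ne_empty.2 hne
  obtain ⟨r, hr, hball⟩ := Metric.isOpen_iff.1 isOpen_interior x hx
  let q : ℝ → Plane := fun t => (x.1 + r / 2 * Real.cos t, x.2 + r / 2 * Real.sin t)
  have hqL : ∀ t, q t ∈ L := by
    intro t
    apply interior_subset (hball _)
    rw [Metric.mem_ball, Prod.dist_eq, max_lt_iff]
    simp only [q, Real.dist_eq, add_sub_cancel_left, abs_mul, abs_of_pos (half_pos hr)]
    constructor
    · nlinarith [Real.abs_cos_le_one t]
    · nlinarith [Real.abs_sin_le_one t]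
  let f : ℝ → ℝ := fun t => Φ.symm ⟨q t, hqL t⟩
  have hf : Continuous f := Φ.symm.continuous.comp (Continuous.subtype_mk (by fun_prop) _)
  have hper : f (Real.pi + Real.pi) = f 0 := by
    simp only [f, q]
    congr 3 <;> simp [← two_mul]
  obtain ⟨t, -, ht⟩ : ∃ t ∈ uIcc 0 Real.pi, f t - f (t + Real.pi) = 0 := by
    have hivt := intermediate_value_uIcc (a := 0) (b := Real.pi)
      (f := fun t => f t - f (t + Real.pi)) (Continuous.continuousOn (by fun_prop))
    apply hivt
    simp only [zero_add, hper, mem_uIcc]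
    rcases le_total (f 0) (f Real.pi) with h | h
    · left; constructor <;> linarith
    · right; constructor <;> linarith
  have heq : q t = q (t + Real.pi) :=
    congrArg Subtype.val (Φ.symm.injective (sub_eq_zero.1 ht))
  simp only [q, Real.cos_add_pi, Real.sin_add_pi, Prod.mk.injEq] at heq
  have hc : Real.cos t = 0 := by nlinarith [heq.1]
  have hs : Real.sin t = 0 := by nlinarith [heq.2]
  have := Real.sin_sq_add_cos_sq t
  simp [hc, hs] at this

theorem isMeagre_line {L : Set Plane} (Φ : ℝ ≃ₜ L) : IsMeagre L := by
  have hcont : Continuous fun t => (Φ t : Plane) := by fun_prop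
  have hsub : L ⊆ ⋃ n : ℕ, (fun t => (Φ t : Plane)) '' Icc (-(n : ℝ)) n := by
    intro w hw
    obtain ⟨n, hn⟩ := exists_nat_ge |Φ.symm ⟨w, hw⟩|
    exact mem_iUnion.2 ⟨n, Φ.symm ⟨w, hw⟩, abs_le.1 hn, by simp⟩
  refine (isMeagre_iUnion fun n => IsNowhereDense.isMeagre ?_).mono hsub
  rw [IsNowhereDense, (isCompact_Icc.image hcont).isClosed.closure_eq]
  refine subset_empty_iff.1 ((interior_mono ?_).trans (interior_line Φ).subset)
  rintro _ ⟨t, -, rfl⟩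
  exact (Φ t).2

theorem IsPortion.exists_le {γ σ : Set Plane} (h : IsPortion γ (γ \ σ)) (Φ : ℝ ≃ₜ γ) :
    ∃ a b : ℝ, a ≤ b ∧ ∀ t, (Φ t : Plane) ∉ σ ↔ t ∈ Ioo a b := by
  obtain ⟨a, b, hab⟩ := h.2 Φ
  have hmem : ∀ t, (Φ t : Plane) ∉ σ ↔ t ∈ Ioo a b := by
    intro t
    rw [← hab]
    simp
  rcases le_total a b with h | h
  · exact ⟨a, b, h, hmem⟩
  · refine ⟨a, a, le_rfl, fun t => (hmem t).trans ?_⟩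
    rw [Ioo_eq_empty h.not_gt, Ioo_self]

theorem closure_portion_subset {γ σ : Set Plane} (Φ : ℝ ≃ₜ γ) {a b : ℝ}
    (h : ∀ t, (Φ t : Plane) ∉ σ ↔ t ∈ Ioo a b) :
    closure (γ \ σ) ⊆ (fun t => (Φ t : Plane)) '' Icc a b := by
  have hcont : Continuous fun t => (Φ t : Plane) := by fun_prop
  refine closure_minimal ?_ (isCompact_Icc.image hcont).isClosed
  rintro w ⟨hw, hwσ⟩
  refine ⟨Φ.symm ⟨w, hw⟩, Ioo_subset_Icc_self ((h _).1 (by simpa using hwσ)), by simp⟩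

theorem subset_closure_portion {γ σ : Set Plane} (Φ : ℝ ≃ₜ γ) {a b : ℝ} (hab : a < b)
    (h : ∀ t, (Φ t : Plane) ∉ σ ↔ t ∈ Ioo a b) :
    (fun t => (Φ t : Plane)) '' Icc a b ⊆ closure (γ \ σ) := by
  have hcont : Continuous fun t => (Φ t : Plane) := by fun_prop
  rw [← closure_Ioo hab.ne]
  refine (image_closure_subset_closure_image hcont).trans (closure_mono ?_)
  rintro _ ⟨t, ht, rfl⟩
  exact ⟨(Φ t).2, (h t).2 ht⟩

/-- A continuous injective real function has no local extremum at an interior point. -/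
theorem exists_lt_and_gt_of_injOn {f : ℝ → ℝ} {s u c : ℝ} (hs : s < c) (hu : c < u)
    (hf : ContinuousOn f (Icc s u)) (hi : InjOn f (Icc s u)) :
    (∃ x ∈ Icc s u, f x < f c) ∧ ∃ x ∈ Icc s u, f c < f x := by
  have hsm : s ∈ Icc s u := ⟨le_rfl, (hs.trans hu).le⟩
  have hum : u ∈ Icc s u := ⟨(hs.trans hu).le, le_rfl⟩
  have hem : c ∈ Icc s u := ⟨hs.le, hu.le⟩
  rcases le_total (f s) (f u) with h | h
  · have := hf.strictMonoOn_of_injOn_Icc (hs.trans hu).le h hi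
    exact ⟨⟨s, hsm, this hsm hem hs⟩, u, hum, this hem hum hu⟩
  · have := hf.strictAntiOn_of_injOn_Icc (hs.trans hu).le h hi
    exact ⟨⟨u, hum, this hem hum hu⟩, s, hsm, this hsm hem hs⟩

/-- The endpoints of the portion `γ \ σ` are adherent to `σ \ γ`. -/
theorem endpoint_mem_closure {γ σ : Set Plane} (Φ : ℝ ≃ₜ γ) (Ψ : ℝ ≃ₜ σ) {a b : ℝ} (hab : a < b)
    (h : ∀ t, (Φ t : Plane) ∉ σ ↔ t ∈ Ioo a b) {c : ℝ} (hc : c = a ∨ c = b) :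
    (Φ c : Plane) ∈ closure (σ \ γ) := by
  classical
  by_contra hcl
  have hcσ : (Φ c : Plane) ∈ σ := by
    by_contra hn
    have := (h c).1 hn
    rcases hc with rfl | rfl
    · exact this.1.ne rfl
    · exact this.2.ne rfl
  set t₀ := Ψ.symm ⟨Φ c, hcσ⟩ with ht₀
  have hΨ : (Ψ t₀ : Plane) = Φ c := by simp [ht₀]
  have hcont : Continuous fun t => (Ψ t : Plane) := by fun_prop
  have hnhds : (fun t => (Ψ t : Plane)) ⁻¹' (closure (σ \ γ))ᶜ ∈ 𝓝 t₀ :=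
    hcont.continuousAt (isClosed_closure.isOpen_compl.mem_nhds (by rwa [hΨ]))
  obtain ⟨ε, hε, hball⟩ := Metric.nhds_basis_closedBall.mem_iff.1 hnhds
  rw [Real.closedBall_eq_Icc] at hball
  set I := Icc (t₀ - ε) (t₀ + ε)
  have hγ : ∀ t ∈ I, (Ψ t : Plane) ∈ γ := fun t ht => by
    by_contra hn
    exact hball ht (subset_closure ⟨(Ψ t).2, hn⟩)
  let f : ℝ → ℝ := fun t => if ht : (Ψ t : Plane) ∈ γ then Φ.symm ⟨Ψ t, ht⟩ else 0
  have hfΦ : ∀ t ∈ I, (Φ (f t) : Plane) = Ψ t := fun t ht => by simp [f, hγ t ht]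
  have hfc : ContinuousOn f I := by
    rw [continuousOn_iff_continuous_domRestrict]
    have : Continuous fun t : I => Φ.symm ⟨Ψ t, hγ t t.2⟩ :=
      Φ.symm.continuous.comp (Continuous.subtype_mk (by fun_prop) _)
    convert! this using 1
    ext t
    simp [f, hγ t t.2]
  have hfi : InjOn f I := by
    intro x hx y hy hxy
    apply Ψ.injective
    apply Subtype.ext
    rw [← hfΦ x hx, ← hfΦ y hy, hxy]
  have ht₀I : t₀ ∈ I := ⟨by linarith, by linarith⟩
  have hft₀ : f t₀ = c := Φ.injective (Subtype.ext (by rw [hfΦ t₀ ht₀I, hΨ]))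
  have havoid : ∀ t ∈ I, f t ∉ Ioo a b := fun t ht hmem =>
    (h _).2 hmem (by rw [hfΦ t ht]; exact (Ψ t).2)
  have himg : OrdConnected (f '' I) := (isPreconnected_Icc.image f hfc).ordConnected
  obtain ⟨⟨x, hx, hxlt⟩, y, hy, hylt⟩ :=
    exists_lt_and_gt_of_injOn (c := t₀) (by linarith) (by linarith) hfc hfi
  rw [hft₀] at hxlt hylt
  have hcI : c ∈ f '' I := ⟨t₀, ht₀I, hft₀⟩
  rcases hc with rfl | rfl
  · have hlt : c < min (f y) b := lt_min hylt hab
    obtain ⟨m, hm1, hm2⟩ := exists_between hlt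
    obtain ⟨t, ht, rfl⟩ := himg.out hcI (mem_image_of_mem f hy)
      ⟨hm1.le, (hm2.trans_le (min_le_left _ _)).le⟩
    exact havoid t ht ⟨hm1, hm2.trans_le (min_le_right _ _)⟩
  · have hlt : max (f x) a < c := max_lt hxlt hab
    obtain ⟨m, hm1, hm2⟩ := exists_between hlt
    obtain ⟨t, ht, rfl⟩ := himg.out (mem_image_of_mem f hx) hcI
      ⟨((le_max_left _ _).trans_lt hm1).le, hm2.le⟩
    exact havoid t ht ⟨(le_max_right _ _).trans_lt hm1, hm2⟩

theorem lineJ_eq (γ σ : Set Plane) : lineJ γ σ = closure (γ \ σ) ∪ closure (σ \ γ) := by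
  rw [lineJ, symmDiff_def, ← closure_union]
  rfl

theorem closure_diff_subset {γ σ : Set Plane} (Φ : ℝ ≃ₜ γ) (h : IsPortion γ (γ \ σ)) :
    closure (γ \ σ) ⊆ γ := by
  obtain ⟨a, b, -, hab⟩ := h.exists_le Φ
  refine (closure_portion_subset Φ hab).trans ?_
  rintro _ ⟨t, -, rfl⟩
  exact (Φ t).2

theorem isCompact_closure_diff {γ σ : Set Plane} (Φ : ℝ ≃ₜ γ) (h : IsPortion γ (γ \ σ)) :
    IsCompact (closure (γ \ σ)) := by
  obtain ⟨a, b, -, hab⟩ := h.exists_le Φ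
  have hcont : Continuous fun t => (Φ t : Plane) := by fun_prop
  exact (isCompact_Icc.image hcont).of_isClosed_subset isClosed_closure
    (closure_portion_subset Φ hab)

theorem isPreconnected_closure_diff {γ σ : Set Plane} (Φ : ℝ ≃ₜ γ) (h : IsPortion γ (γ \ σ)) :
    IsPreconnected (closure (γ \ σ)) := by
  obtain ⟨a, b, -, hab⟩ := h.exists_le Φ
  have hcont : Continuous fun t => (Φ t : Plane) := by fun_prop
  have himg : γ \ σ = (fun t => (Φ t : Plane)) '' Ioo a b := by
    ext w
    constructor
    · rintro ⟨hw, hwσ⟩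
      exact ⟨Φ.symm ⟨w, hw⟩, (hab _).1 (by simpa using hwσ), by simp⟩
    · rintro ⟨t, ht, rfl⟩
      exact ⟨(Φ t).2, (hab t).2 ht⟩
  rw [himg]
  exact (isPreconnected_Ioo.image _ hcont.continuousOn).closure

/-- Logarithms along `γ` and `σ` that differ by a constant on `γ ∩ σ` glue on `lineJ γ σ`. -/
theorem exists_isLogOn_lineJ {γ σ : Set Plane} (Φ : ℝ ≃ₜ γ) (Ψ : ℝ ≃ₜ σ)
    (hγσ : IsPortion γ (γ \ σ)) (hσγ : IsPortion σ (σ \ γ)) {p : Plane} {l m : Plane → ℂ}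
    (hl : IsLogOn l γ p) (hm : IsLogOn m σ p) {c : ℂ} (hc : ∀ w ∈ γ ∩ σ, l w - m w = c) :
    ∃ g, IsLogOn g (lineJ γ σ) p := by
  classical
  have hA := closure_diff_subset Φ hγσ
  have hB := closure_diff_subset Ψ hσγ
  by_cases hne : (γ ∩ σ).Nonempty
  · obtain ⟨w₀, hw₀⟩ := hne
    have hexp : Complex.exp c = 1 := by
      rw [← hc w₀ hw₀, Complex.exp_sub, hl.2 _ hw₀.1, ← hm.2 _ hw₀.2,
        div_self (Complex.exp_ne_zero _)]
    let g : Plane → ℂ := (closure (γ \ σ)).piecewise l fun w => m w + c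
    have hgA : ∀ w ∈ closure (γ \ σ), g w = l w := fun w hw => piecewise_eq_of_mem _ _ _ hw
    have hgB : ∀ w ∈ closure (σ \ γ), g w = m w + c := by
      intro w hw
      by_cases hwA : w ∈ closure (γ \ σ)
      · rw [hgA w hwA, ← hc w ⟨hA hwA, hB hw⟩]; ring
      · exact piecewise_eq_of_notMem _ _ _ hwA
    refine ⟨g, ?_, ?_⟩
    · rw [lineJ_eq]
      exact ContinuousOn.union_of_isClosed ((hl.1.mono hA).congr hgA)
        (((hm.1.mono hB).add continuousOn_const).congr hgB) isClosed_closure isClosed_closure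
    · rw [lineJ_eq]
      rintro w (hw | hw)
      · rw [hgA w hw, hl.2 w (hA hw)]
      · rw [hgB w hw, Complex.exp_add, hexp, mul_one, hm.2 w (hB hw)]
  · have hdisj : ∀ w ∈ closure (σ \ γ), w ∉ closure (γ \ σ) := fun w hw hwA =>
      hne ⟨w, hA hwA, hB hw⟩
    refine ⟨(closure (γ \ σ)).piecewise l m, ?_, ?_⟩
    · rw [lineJ_eq]
      exact ContinuousOn.union_of_isClosed
        ((hl.1.mono hA).congr fun w hw => piecewise_eq_of_mem _ _ _ hw)
        ((hm.1.mono hB).congr fun w hw => piecewise_eq_of_notMem _ _ _ (hdisj w hw))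
        isClosed_closure isClosed_closure
    · rw [lineJ_eq]
      rintro w (hw | hw)
      · rw [piecewise_eq_of_mem _ _ _ hw, hl.2 w (hA hw)]
      · rw [piecewise_eq_of_notMem _ _ _ (hdisj w hw), hm.2 w (hB hw)]

/-- Logarithms along `γ` and `σ` differ by a constant on every connected parameter set of `γ`
mapped into `σ`. -/
theorem sub_eq_sub_of_mem {γ σ : Set Plane} (Φ : ℝ ≃ₜ γ) {p : Plane} {l m : Plane → ℂ}
    (hl : IsLogOn l γ p) (hm : IsLogOn m σ p) {S : Set ℝ} (hS : IsPreconnected S)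
    (hSσ : ∀ t ∈ S, (Φ t : Plane) ∈ σ) {s t : ℝ} (hs : s ∈ S) (ht : t ∈ S) :
    l (Φ s) - m (Φ s) = l (Φ t) - m (Φ t) := by
  have hcont : Continuous fun t => (Φ t : Plane) := by fun_prop
  have hsub : (fun t => (Φ t : Plane)) '' S ⊆ γ ∩ σ := by
    rintro _ ⟨t, ht, rfl⟩
    exact ⟨(Φ t).2, hSσ t ht⟩
  exact (hl.mono (hsub.trans inter_subset_left)).sub_eq_sub
    (hm.mono (hsub.trans inter_subset_right)) (hS.image _ hcont.continuousOn)
    (mem_image_of_mem _ hs) (mem_image_of_mem _ ht)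

/-- If logarithms along `γ` and `σ` have the same difference at some points of both common ends,
they differ by a constant on `γ ∩ σ`. -/
theorem sub_eq_of_ends {γ σ : Set Plane} (Φ : ℝ ≃ₜ γ) {p : Plane} {l m : Plane → ℂ}
    (hl : IsLogOn l γ p) (hm : IsLogOn m σ p) {a b : ℝ}
    (h : ∀ t, (Φ t : Plane) ∉ σ ↔ t ∈ Ioo a b) {s t : ℝ} {c : ℂ} (hs : s ≤ a) (ht : b ≤ t)
    (hcs : l (Φ s) - m (Φ s) = c) (hct : l (Φ t) - m (Φ t) = c) :
    ∀ w ∈ γ ∩ σ, l w - m w = c := by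
  rintro w ⟨hwγ, hwσ⟩
  obtain ⟨x, hx⟩ := Φ.surjective ⟨w, hwγ⟩
  obtain rfl : (Φ x : Plane) = w := by rw [hx]
  have hxI : x ∉ Ioo a b := fun hxI => (h x).2 hxI hwσ
  rcases le_or_gt x a with hxa | hxa
  · rw [← hcs]
    exact sub_eq_sub_of_mem Φ hl hm isPreconnected_Iic
      (fun t ht => by by_contra hn; exact ((h t).1 hn).1.not_ge ht) hxa hs
  · have hbx : b ≤ x := by
      by_contra! hlt
      exact hxI ⟨hxa, hlt⟩
    rw [← hct]
    exact sub_eq_sub_of_mem Φ hl hm isPreconnected_Ici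
      (fun t ht => by by_contra hn; exact ((h t).1 hn).2.not_ge ht) hbx ht

/-- A logarithm on `lineJ γ σ` forces logarithms along `γ` and `σ` to differ by a constant on
`γ ∩ σ`. -/
theorem IsLogOn.exists_sub_eq {γ σ : Set Plane} (Φ : ℝ ≃ₜ γ) (Ψ : ℝ ≃ₜ σ)
    (hγσ : IsPortion γ (γ \ σ)) (hσγ : IsPortion σ (σ \ γ)) {p : Plane} {g l m : Plane → ℂ}
    (hg : IsLogOn g (lineJ γ σ) p) (hl : IsLogOn l γ p) (hm : IsLogOn m σ p) :
    ∃ c : ℂ, ∀ w ∈ γ ∩ σ, l w - m w = c := by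
  obtain ⟨a, b, hab, h⟩ := hγσ.exists_le Φ
  suffices hends : l (Φ b) - m (Φ b) = l (Φ a) - m (Φ a) from
    ⟨_, sub_eq_of_ends Φ hl hm h le_rfl le_rfl rfl hends⟩
  rcases hab.eq_or_lt with rfl | hlt
  · rfl
  rw [lineJ_eq] at hg
  have h1 := (hg.mono subset_union_left).sub_eq_sub (hl.mono (closure_diff_subset Φ hγσ))
    (isPreconnected_closure_diff Φ hγσ)
    (subset_closure_portion Φ hlt h (mem_image_of_mem _ (left_mem_Icc.2 hab)))
    (subset_closure_portion Φ hlt h (mem_image_of_mem _ (right_mem_Icc.2 hab)))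
  have h2 := (hg.mono subset_union_right).sub_eq_sub (hm.mono (closure_diff_subset Ψ hσγ))
    (isPreconnected_closure_diff Ψ hσγ)
    (endpoint_mem_closure Φ Ψ hlt h (Or.inl rfl)) (endpoint_mem_closure Φ Ψ hlt h (Or.inr rfl))
  linear_combination h1 - h2

theorem isOpen_intRegion {J : Set Plane} (hJ : IsClosed J) : IsOpen (intRegion J) := by
  rw [isOpen_iff_mem_nhds]
  rintro z ⟨hz, hb⟩
  refine Filter.mem_of_superset (hJ.isOpen_compl.connectedComponentIn.mem_nhds
    (mem_connectedComponentIn hz)) fun w hw => ?_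
  refine ⟨connectedComponentIn_subset _ _ hw, ?_⟩
  rwa [← connectedComponentIn_eq hw]

theorem exists_isLogOn_of_notMem_intRegion {γ σ : Set Plane} (Φ : ℝ ≃ₜ γ) (Ψ : ℝ ≃ₜ σ)
    (hγσ : IsPortion γ (γ \ σ)) (hσγ : IsPortion σ (σ \ γ)) {p : Plane} (hpγ : p ∉ γ)
    (hpσ : p ∉ σ) (hp : p ∉ intRegion (lineJ γ σ)) : ∃ g, IsLogOn g (lineJ γ σ) p := by
  have hpJ : p ∉ lineJ γ σ := by
    rw [lineJ_eq]
    rintro (h | h)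
    · exact hpγ (closure_diff_subset Φ hγσ h)
    · exact hpσ (closure_diff_subset Ψ hσγ h)
  refine exists_isLogOn_of_not_isBounded ?_ hpJ fun hb => hp ⟨hpJ, hb⟩
  rw [lineJ_eq]
  exact (isCompact_closure_diff Φ hγσ).union (isCompact_closure_diff Ψ hσγ)


theorem stmt11 (Γ : Set (Set Plane)) (hline : ∀ γ ∈ Γ, IsTopLine γ)
    (hport : ∀ γ ∈ Γ, ∀ γ' ∈ Γ, γ ≠ γ' → IsPortion γ (γ \ γ'))
    (γ σ σ' : Set Plane) (hγ : γ ∈ Γ) (hσ : σ ∈ Γ) (hσ' : σ' ∈ Γ)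
    (h1 : γ ≠ σ) (h2 : γ ≠ σ') (h3 : σ ≠ σ') :
    closure (intRegion (lineJ γ σ')) \ closure (intRegion (lineJ γ σ)) ⊆
      closure (intRegion (lineJ σ σ')) := by
  obtain ⟨Φ⟩ := hline γ hγ
  obtain ⟨Ψ⟩ := hline σ hσ
  obtain ⟨Ψ'⟩ := hline σ' hσ'
  have p12 := hport γ hγ σ hσ h1
  have p21 := hport σ hσ γ hγ h1.symm
  have p13 := hport γ hγ σ' hσ' h2
  have p31 := hport σ' hσ' γ hγ h2.symm
  have p23 := hport σ hσ σ' hσ' h3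
  have p32 := hport σ' hσ' σ hσ h3.symm
  rintro x ⟨hx, hxn⟩
  rw [mem_closure_iff]
  intro V hV hxV
  obtain ⟨y, ⟨hyV, hyn⟩, hy⟩ := mem_closure_iff.1 hx (V ∩ (closure (intRegion (lineJ γ σ)))ᶜ)
    (hV.inter isClosed_closure.isOpen_compl) ⟨hxV, hxn⟩
  have hO : IsOpen ((V ∩ (closure (intRegion (lineJ γ σ)))ᶜ) ∩ intRegion (lineJ γ σ')) :=
    (hV.inter isClosed_closure.isOpen_compl).inter (isOpen_intRegion isClosed_closure)
  obtain ⟨p, ⟨⟨hpV, hpn⟩, hpi⟩, hp⟩ : (((V ∩ (closure (intRegion (lineJ γ σ)))ᶜ) ∩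
      intRegion (lineJ γ σ')) ∩ (γ ∪ σ ∪ σ')ᶜ).Nonempty :=
    (dense_of_mem_residual (((isMeagre_line Φ).union (isMeagre_line Ψ)).union
      (isMeagre_line Ψ'))).inter_open_nonempty _ hO ⟨y, ⟨hyV, hyn⟩, hy⟩
  simp only [mem_compl_iff, mem_union, not_or] at hp
  obtain ⟨⟨hpγ, hpσ⟩, hpσ'⟩ := hp
  refine ⟨p, hpV, ?_⟩
  by_contra hpi'
  obtain ⟨l, hl⟩ := exists_isLogOn_line Φ hpγ
  obtain ⟨m, hm⟩ := exists_isLogOn_line Ψ hpσ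
  obtain ⟨m', hm'⟩ := exists_isLogOn_line Ψ' hpσ'
  obtain ⟨g, hg⟩ := exists_isLogOn_of_notMem_intRegion Φ Ψ p12 p21 hpγ hpσ
    fun h => hpn (subset_closure h)
  obtain ⟨g', hg'⟩ := exists_isLogOn_of_notMem_intRegion Ψ Ψ' p23 p32 hpσ hpσ' hpi'
  obtain ⟨c, hc⟩ := hg.exists_sub_eq Φ Ψ p12 p21 hl hm
  obtain ⟨c', hc'⟩ := hg'.exists_sub_eq Ψ Ψ' p23 p32 hm hm'
  obtain ⟨a, b, -, hab⟩ := p12.exists_le Φ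
  obtain ⟨a', b', -, hab'⟩ := p13.exists_le Φ
  have hcommon : ∀ t, t ∉ Ioo a b → t ∉ Ioo a' b' → l (Φ t) - m' (Φ t) = c + c' := by
    intro t ht ht'
    have hσt : (Φ t : Plane) ∈ σ := by_contra fun hn => ht ((hab t).1 hn)
    have hσt' : (Φ t : Plane) ∈ σ' := by_contra fun hn => ht' ((hab' t).1 hn)
    linear_combination hc _ ⟨(Φ t).2, hσt⟩ + hc' _ ⟨hσt, hσt'⟩
  have hdiff := sub_eq_of_ends Φ hl hm' hab' (s := min a a') (t := max b b') (min_le_right _ _)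
    (le_max_right _ _)
    (hcommon _ (fun h => h.1.not_ge (min_le_left _ _)) fun h => h.1.not_ge (min_le_right _ _))
    (hcommon _ (fun h => h.2.not_ge (le_max_left _ _)) fun h => h.2.not_ge (le_max_right _ _))
  obtain ⟨k, hk⟩ := exists_isLogOn_lineJ Φ Ψ' p13 p31 hl hm' hdiff
  exact not_isLogOn_of_isBounded isClosed_closure hpi.1 hpi.2 k hk
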